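/- arXiv:2006.13209 — 4 statements merged into one kernel-verified Lean document; each statement's English description precedes it below -/
import Mathlib

section
/- If μ is a stable matching of the consolidated school choice problem (T, S, ≻, ▷, q) and every student who is matched under μ is assigned to a school in their own district of the partition 𝒟, then for each district D ∈ 𝒟 the restriction of μ to the students and schools of D is a stable matching of the district-level school choice problem (in which students' preferences and schools' priorities are restricted to the members of D). -/
/-- The set of students (among those satisfying `P`) assigned to school `s` under `μ`. -/
def assignedIn {T S : Type*} (P : T → Prop) (μ : T → Option S) (s : S) : Set T :=
  {t | P t ∧ μ t = some s}

/-- `prefOpt pref s o` holds iff school `s` is strictly preferred to the assignment `o`;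
being matched to any school is preferred to being unmatched. -/
def prefOpt {S : Type*} (pref : S → S → Prop) (s : S) : Option S → Prop
  | none => True
  | some s' => pref s s'

/-- Stability of the matching `μ` restricted to students in `P` and schools in `Q`:
there is no blocking pair `(t, s)` with `P t` and `Q s`, where a pair blocks if either
(i) `t` is unmatched and `s` has a vacant seat, or (ii) `t` strictly prefers `s` to their
current assignment and `s` prioritises `t` over one of its currently assigned students. -/
def StableWithin {T S : Type*} (P : T → Prop) (Q : S → Prop) (q : S → ℕ)
    (pref : T → S → S → Prop) (prio : S → T → T → Prop) (μ : T → Option S) : Prop :=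
  ¬ ∃ t s, P t ∧ Q s ∧
    ((μ t = none ∧ (assignedIn P μ s).ncard < q s) ∨
     (prefOpt (pref t) s (μ t) ∧ ∃ t' ∈ assignedIn P μ s, prio s t t'))

/-- If `μ` is a stable matching of the consolidated school choice problem and every matched
student is assigned to a school in their own district, then for each district `d` the
restriction of `μ` to the students and schools of `d` is a stable matching of the
district-level school choice problem. -/
theorem restriction_of_consolidated_stable_matching_is_district_stable
    {T S D : Type*} [Fintype T] [Fintype S]
    (q : S → ℕ) (hq : ∀ s, 1 ≤ q s)
    (pref : T → S → S → Prop) (prio : S → T → T → Prop)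
    (hpref : ∀ t, IsStrictTotalOrder S (pref t))
    (hprio : ∀ s, IsStrictTotalOrder T (prio s))
    (dT : T → D) (dS : S → D)
    (hD : ∀ d : D, (∃ t, dT t = d) ∧ (∃ s, dS s = d))
    (μ : T → Option S)
    (hcap : ∀ s, (assignedIn (fun _ => True) μ s).ncard ≤ q s)
    (hstable : StableWithin (fun _ => True) (fun _ => True) q pref prio μ)
    (hown : ∀ t s, μ t = some s → dT t = dS s) :
    ∀ d : D,
      (∀ s, dS s = d → (assignedIn (fun t => dT t = d) μ s).ncard ≤ q s) ∧
      StableWithin (fun t => dT t = d) (fun s => dS s = d) q pref prio μ := by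
  intro d
  have key : ∀ s, dS s = d →
      assignedIn (fun t => dT t = d) μ s = assignedIn (fun _ => True) μ s := fun s hs =>
    Set.ext fun t => ⟨fun h => ⟨trivial, h.2⟩, fun h => ⟨(hown t s h.2).trans hs, h.2⟩⟩
  refine ⟨fun s hs => (key s hs).symm ▸ hcap s, ?_⟩
  rintro ⟨t, s, -, hs, hblock⟩
  rw [key s hs] at hblock
  exact hstable ⟨t, s, trivial, trivial, hblock⟩
end

section
/- (Proposition 1: sometimes all students are made weakly worse off by district consolidation.) Let (T, S, 𝒟', ≻, ▷, q) be an extended school choice problem, let μ_Ω be a stable matching of the consolidated problem such that every student who is matched under μ_Ω is assigned to a school in their own district (property (1)), and for each district D ∈ 𝒟' let μ_D be a student-optimal stable matching of the district-level problem, i.e. a stable matching of the district problem that every student of D weakly prefers to every stable matching of the district problem. Then every student t weakly prefers their district-level assignment μ_D(t) to their consolidated assignment μ_Ω(t). -/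
/-- Weak preference between assignments: any outcome is weakly preferred to being
unmatched, and among schools `s` is weakly preferred to `s'` iff `s = s'` or `s ≻ s'`. -/
def wPref {S : Type*} (pref : S → S → Prop) : Option S → Option S → Prop
  | none, none => True
  | some _, none => True
  | none, some _ => False
  | some s, some s' => s = s' ∨ pref s s'

/-- A stable matching that sends every matched student to a school of their own district
restricts to a stable matching of each district-level problem. -/
theorem StableWithin.restrict_district {T S D : Type*} {q : S → ℕ}
    {pref : T → S → S → Prop} {prio : S → T → T → Prop} {dT : T → D} {dS : S → D}
    {μ μ' : T → Option S}
    (hμ : StableWithin (fun _ => True) (fun _ => True) q pref prio μ)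
    (hown : ∀ t s, μ t = some s → dT t = dS s) (d : D) (hμ' : ∀ t, dT t = d → μ' t = μ t) :
    StableWithin (fun t => dT t = d) (fun s => dS s = d) q pref prio μ' := by
  rintro ⟨t, s, ht, hs, hblock⟩
  have hassigned : assignedIn (fun t => dT t = d) μ' s = assignedIn (fun _ => True) μ s := by
    ext u
    constructor
    · rintro ⟨hu, hus⟩
      exact ⟨trivial, hμ' u hu ▸ hus⟩
    · rintro ⟨-, hus⟩
      have hu : dT u = d := (hown u s hus).trans hs
      exact ⟨hu, (hμ' u hu).trans hus⟩
  rw [hassigned, hμ' t ht] at hblock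
  exact hμ ⟨t, s, trivial, trivial, hblock⟩

/-- Proposition 1: if `μΩ` is a stable matching of the consolidated problem in which every
matched student is assigned to a school in their own district (property (1)), and `ν`
is, district by district, a student-optimal stable matching of the district-level
problems, then every student weakly prefers their district-level assignment `ν t` to
their consolidated assignment `μΩ t`. -/
theorem all_students_weakly_worse_off_after_consolidation
    {T S D : Type*} [Fintype T] [Fintype S]
    (q : S → ℕ) (hq : ∀ s, 1 ≤ q s)
    (pref : T → S → S → Prop) (prio : S → T → T → Prop)
    (hpref : ∀ t, IsStrictTotalOrder S (pref t))
    (hprio : ∀ s, IsStrictTotalOrder T (prio s))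
    (dT : T → D) (dS : S → D)
    (hD : ∀ d : D, (∃ t, dT t = d) ∧ (∃ s, dS s = d))
    -- `μΩ`: a stable matching of the consolidated problem satisfying property (1)
    (μΩ : T → Option S)
    (hΩcap : ∀ s, (assignedIn (fun _ => True) μΩ s).ncard ≤ q s)
    (hΩstable : StableWithin (fun _ => True) (fun _ => True) q pref prio μΩ)
    (hown : ∀ t s, μΩ t = some s → dT t = dS s)
    -- `ν`: the combined district-level matchings, each one a student-optimal stable
    -- matching of its district-level problem
    (ν : T → Option S)
    (hνdist : ∀ t s, ν t = some s → dT t = dS s)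
    (hνcap : ∀ s, (assignedIn (fun _ => True) ν s).ncard ≤ q s)
    (hνstable : ∀ d : D,
      StableWithin (fun t => dT t = d) (fun s => dS s = d) q pref prio ν)
    (hνopt : ∀ d : D, ∀ μ' : T → Option S,
      (∀ t s, μ' t = some s → dT t = d ∧ dS s = d) →
      (∀ s, (assignedIn (fun _ => True) μ' s).ncard ≤ q s) →
      StableWithin (fun t => dT t = d) (fun s => dS s = d) q pref prio μ' →
      ∀ t, dT t = d → wPref (pref t) (ν t) (μ' t)) :
    -- every student weakly prefers the district-level assignment to the consolidated one
    ∀ t, wPref (pref t) (ν t) (μΩ t) := by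
  classical
  intro t
  let μ' : T → Option S := fun u => if dT u = dT t then μΩ u else none
  have hμ' : ∀ u, dT u = dT t → μ' u = μΩ u := fun u hu => if_pos hu
  have hsome : ∀ u s, μ' u = some s → dT u = dT t ∧ μΩ u = some s := by
    intro u s hus
    by_cases hu : dT u = dT t
    · exact ⟨hu, hμ' u hu ▸ hus⟩
    · simp [μ', hu] at hus
  rw [← hμ' t rfl]
  refine hνopt (dT t) μ' ?_ ?_ (hΩstable.restrict_district hown (dT t) hμ') t rfl
  · intro u s hus
    obtain ⟨hu, hΩ⟩ := hsome u s hus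
    exact ⟨hu, (hown u s hΩ).symm.trans hu⟩
  · intro s
    refine (Set.ncard_le_ncard ?_ (Set.toFinite _)).trans (hΩcap s)
    rintro u ⟨-, hus⟩
    exact ⟨trivial, (hsome u s hus).2⟩
end

section
/- There exists an extended school choice problem in which, when a student-optimal stable matching is chosen both in each district-level problem and in the consolidated problem, at least two students are matched to a strictly less preferred school after consolidation and no student is matched to a strictly more preferred school. Concretely: take students t1,t2,t3 and schools s1,s2,s3 each of capacity 1, districts D1={t1,t2,s1,s2} and D2={t3,s3}, preferences t1: s2 ≻ s1 ≻ s3, t2: s1 ≻ s2 ≻ s3, t3: s1 ≻ s3 ≻ s2, and priorities s1: t1 ▷ t3 ▷ t2, s2: t2 ▷ t1 ▷ t3, s3: t3 ▷ t1 ▷ t2. Then the matching {(t1,s2),(t2,s1),(t3,s3)} is the student-optimal stable matching of the district-level problems, the matching {(t1,s1),(t2,s2),(t3,s3)} is the student-optimal stable matching of the consolidated problem, and hence exactly two students (t1 and t2) are strictly worse off after consolidation while zero students are strictly better off. -/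
/- Students `0, 1, 2` are `t1, t2, t3`; schools `0, 1, 2` are `s1, s2, s3`. -/

/-- Students' rank of each school (lower is better):
`t1 : s2 ≻ s1 ≻ s3`, `t2 : s1 ≻ s2 ≻ s3`, `t3 : s1 ≻ s3 ≻ s2`. -/
def studentRank : Fin 3 → Fin 3 → ℕ := ![![1, 0, 2], ![0, 1, 2], ![0, 2, 1]]

/-- Schools' rank of each student (lower is higher priority):
`s1 : t1 ▷ t3 ▷ t2`, `s2 : t2 ▷ t1 ▷ t3`, `s3 : t3 ▷ t1 ▷ t2`. -/
def schoolRank : Fin 3 → Fin 3 → ℕ := ![![0, 2, 1], ![1, 0, 2], ![1, 2, 0]]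

/-- Student `t` strictly prefers school `s` to school `s'`. -/
def examplePref (t : Fin 3) (s s' : Fin 3) : Prop := studentRank t s < studentRank t s'

/-- School `s` strictly prioritises student `t` over student `t'`. -/
def examplePrio (s : Fin 3) (t t' : Fin 3) : Prop := schoolRank s t < schoolRank s t'

/-- All schools have capacity one. -/
def exampleQ : Fin 3 → ℕ := fun _ => 1

/-- District of each student: `D1 = {t1, t2}`, `D2 = {t3}`. -/
def exampleDT : Fin 3 → Fin 2 := ![0, 0, 1]

/-- District of each school: `D1 = {s1, s2}`, `D2 = {s3}`. -/
def exampleDS : Fin 3 → Fin 2 := ![0, 0, 1]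

/-- The district-level matching `{(t1, s2), (t2, s1), (t3, s3)}`. -/
def μdist : Fin 3 → Option (Fin 3) := ![some 1, some 0, some 2]

/-- The consolidated matching `{(t1, s1), (t2, s2), (t3, s3)}`. -/
def μcons : Fin 3 → Option (Fin 3) := ![some 0, some 1, some 2]

/-- The number of assigned students, as the cardinality of a filtered finset. -/
theorem ncard_assignedIn {T S : Type*} [Fintype T] [DecidableEq S] (P : T → Prop)
    [DecidablePred P] (μ : T → Option S) (s : S) :
    (assignedIn P μ s).ncard = (Finset.univ.filter fun t => P t ∧ μ t = some s).card := by
  rw [← Set.ncard_coe_finset]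
  congr 1
  ext t
  simp [assignedIn]

instance decidableExamplePref (t s s' : Fin 3) : Decidable (examplePref t s s') :=
  inferInstanceAs (Decidable (studentRank t s < studentRank t s'))

instance decidableExamplePrio (s t t' : Fin 3) : Decidable (examplePrio s t t') :=
  inferInstanceAs (Decidable (schoolRank s t < schoolRank s t'))

instance decidablePrefOpt {S : Type*} (pref : S → S → Prop) [DecidableRel pref] (s : S) :
    (o : Option S) → Decidable (prefOpt pref s o)
  | none => inferInstanceAs (Decidable True)
  | some s' => inferInstanceAs (Decidable (pref s s'))

instance decidableWPref {S : Type*} [DecidableEq S] (pref : S → S → Prop) [DecidableRel pref] :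
    (o o' : Option S) → Decidable (wPref pref o o')
  | none, none => inferInstanceAs (Decidable True)
  | some _, none => inferInstanceAs (Decidable True)
  | none, some _ => inferInstanceAs (Decidable False)
  | some s, some s' => inferInstanceAs (Decidable (s = s' ∨ pref s s'))

instance decidableMemAssignedIn {T S : Type*} [DecidableEq S] (P : T → Prop) [DecidablePred P]
    (μ : T → Option S) (s : S) (t : T) : Decidable (t ∈ assignedIn P μ s) :=
  inferInstanceAs (Decidable (P t ∧ μ t = some s))

/-- Example 1: an extended school choice problem in which, choosing the student-optimal
stable matching in each district-level problem and in the consolidated problem, exactly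
two students (`t1` and `t2`) are matched to a strictly less preferred school after
consolidation and no student is matched to a strictly more preferred school. -/
theorem consolidation_can_harm_all_students :
    -- `μdist` is a matching assigning each student within their own district
    (∀ s, (assignedIn (fun _ => True) μdist s).ncard ≤ exampleQ s) ∧
    (∀ t s, μdist t = some s → exampleDT t = exampleDS s) ∧
    -- `μdist` is stable in each district-level problem
    (∀ d : Fin 2, StableWithin (fun t => exampleDT t = d) (fun s => exampleDS s = d)
      exampleQ examplePref examplePrio μdist) ∧
    -- `μdist` is student-optimal among the district-level stable matchings
    (∀ d : Fin 2, ∀ μ' : Fin 3 → Option (Fin 3),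
      (∀ t s, μ' t = some s → exampleDT t = d ∧ exampleDS s = d) →
      (∀ s, (assignedIn (fun _ => True) μ' s).ncard ≤ exampleQ s) →
      StableWithin (fun t => exampleDT t = d) (fun s => exampleDS s = d)
        exampleQ examplePref examplePrio μ' →
      ∀ t, exampleDT t = d → wPref (examplePref t) (μdist t) (μ' t)) ∧
    -- `μcons` is a stable matching of the consolidated problem
    (∀ s, (assignedIn (fun _ => True) μcons s).ncard ≤ exampleQ s) ∧
    StableWithin (fun _ => True) (fun _ => True)
      exampleQ examplePref examplePrio μcons ∧
    -- `μcons` is the student-optimal stable matching of the consolidated problem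
    (∀ μ' : Fin 3 → Option (Fin 3),
      (∀ s, (assignedIn (fun _ => True) μ' s).ncard ≤ exampleQ s) →
      StableWithin (fun _ => True) (fun _ => True)
        exampleQ examplePref examplePrio μ' →
      ∀ t, wPref (examplePref t) (μcons t) (μ' t)) ∧
    -- exactly two students, `t1` and `t2`, are strictly worse off after consolidation
    {t : Fin 3 | ∃ s s', μdist t = some s ∧ μcons t = some s' ∧ examplePref t s s'}
      = {0, 1} ∧
    -- and no student is strictly better off after consolidation
    {t : Fin 3 | ∃ s s', μdist t = some s ∧ μcons t = some s' ∧ examplePref t s' s}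
      = ∅ := by
  simp only [StableWithin, ncard_assignedIn, Set.ext_iff, Set.mem_ofPred_eq, Set.mem_insert_iff,
    Set.mem_singleton_iff, Set.mem_empty_iff_false]
  -- `μdist` gives each student the favourite school of the district
  have best : ∀ d : Fin 2, ∀ μ' : Fin 3 → Option (Fin 3),
      (∀ t s, μ' t = some s → exampleDT t = d ∧ exampleDS s = d) →
      ∀ t, exampleDT t = d → wPref (examplePref t) (μdist t) (μ' t) := by
    decide +kernel
  refine ⟨?_, ?_, ?_, fun d μ' h _ _ => best d μ' h, ?_, ?_, ?_, ?_, ?_⟩ <;> decide +kernel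
end

section
/- Let A ⊆ B be finite sets with |A| = a and |B| = m, fix a strict linear order on A, let x ∈ A be the element of rank h within A, and choose uniformly at random a strict linear order on B whose restriction to A equals the fixed order. Then the expected rank of x within B (the expected value of |{z ∈ B : z weakly above x}|) equals h + h·(m − a)/(a + 1). -/
section UniformExtension

variable {β : Type*}

/-- `ord` restricts to a strict linear order on `A`. -/
structure StrictLinearOn (A : Finset β) (ord : β → β → Prop) : Prop where
  irrefl : ∀ u ∈ A, ¬ ord u u
  trans : ∀ u ∈ A, ∀ z ∈ A, ∀ w ∈ A, ord u z → ord z w → ord u w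
  total : ∀ u ∈ A, ∀ z ∈ A, u ≠ z → ord u z ∨ ord z u

/-- The ranking `σ` agrees with `ord` on `A`. -/
abbrev Extends {n : ℕ} (A : Finset β) (ord : β → β → Prop) (σ : β ≃ Fin n) : Prop :=
  ∀ u ∈ A, ∀ z ∈ A, (ord u z ↔ σ u < σ z)

/-- The number of elements of `A` strictly above `u` in the order `ord`. -/
def numAbove (A : Finset β) (ord : β → β → Prop) [DecidableRel ord] (u : β) : ℕ :=
  (A.filter (fun v => ord v u)).card

/-- The number of elements of `A` that `σ` ranks strictly above `z`. -/
def gap {n : ℕ} (A : Finset β) (z : β) (σ : β ≃ Fin n) : ℕ :=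
  (A.filter (fun v => σ v < σ z)).card

variable {A : Finset β} {ord : β → β → Prop} {n : ℕ}

/-- Swapping `z ∉ A` with `u ∈ A` preserves the order on `A` when no other element of `A`
lies between them. -/
theorem Extends.swap [DecidableEq β] {σ : β ≃ Fin n} (hσ : Extends A ord σ) {u z : β} (hz : z ∉ A)
    (hadj : ∀ v ∈ A, v ≠ u → (σ v < σ z ↔ σ v < σ u)) :
    Extends A ord ((Equiv.swap z u).trans σ) := by
  have hne : ∀ v w, v ≠ w → σ v ≠ σ w := fun v w h => σ.injective.ne h
  have key : ∀ v ∈ A, v ≠ u → (Equiv.swap z u) v = v := fun v hv hvu =>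
    Equiv.swap_apply_of_ne_of_ne (fun h => hz (h ▸ hv)) hvu
  have hzv : ∀ v ∈ A, z ≠ v := fun v hv h => hz (h ▸ hv)
  intro v hv w hw
  rw [hσ v hv w hw]
  simp only [Equiv.trans_apply]
  by_cases hvu : v = u <;> by_cases hwu : w = u
  · simp [hvu, hwu]
  · subst hvu
    rw [key w hw hwu, Equiv.swap_apply_right]
    have h1 := hadj w hw hwu
    have h2 := hne _ _ hwu
    have h3 := hne _ _ (hzv w hw)
    grind
  · subst hwu
    rw [key v hv hvu, Equiv.swap_apply_right, hadj v hv hvu]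
  · rw [key v hv hvu, key w hw hwu]

variable [DecidableRel ord]

theorem numAbove_lt_of_ord (hA : StrictLinearOn A ord) {u v : β} (hu : u ∈ A) (hv : v ∈ A)
    (huv : ord u v) : numAbove A ord u < numAbove A ord v := by
  apply Finset.card_lt_card
  rw [Finset.ssubset_iff_of_subset]
  · exact ⟨u, by simp [hu, huv], by simp [hA.irrefl u hu]⟩
  · intro w hw
    rw [Finset.mem_filter] at hw ⊢
    exact ⟨hw.1, hA.trans w hw.1 u hu v hv hw.2 huv⟩

theorem numAbove_lt_iff (hA : StrictLinearOn A ord) {u v : β} (hu : u ∈ A) (hv : v ∈ A) :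
    numAbove A ord u < numAbove A ord v ↔ ord u v := by
  refine ⟨fun hlt => ?_, numAbove_lt_of_ord hA hu hv⟩
  rcases eq_or_ne u v with rfl | hne
  · exact absurd hlt (lt_irrefl _)
  · rcases hA.total u hu v hv hne with huv | hvu
    · exact huv
    · exact absurd (numAbove_lt_of_ord hA hv hu hvu) hlt.asymm

theorem numAbove_injOn (hA : StrictLinearOn A ord) : Set.InjOn (numAbove A ord) A := by
  intro u hu v hv huv
  by_contra hne
  rcases hA.total u hu v hv hne with h | h
  · exact (numAbove_lt_of_ord hA hu hv h).ne huv
  · exact (numAbove_lt_of_ord hA hv hu h).ne huv.symm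

theorem numAbove_lt_card (hA : StrictLinearOn A ord) {u : β} (hu : u ∈ A) :
    numAbove A ord u < A.card := by
  apply Finset.card_lt_card
  rw [Finset.ssubset_iff_of_subset (Finset.filter_subset _ _)]
  exact ⟨u, hu, by simp [hA.irrefl u hu]⟩

theorem exists_numAbove_eq (hA : StrictLinearOn A ord) {k : ℕ} (hk : k < A.card) :
    ∃ u ∈ A, numAbove A ord u = k := by
  have hsurj := Finset.surjOn_of_injOn_of_card_le (s := A) (t := Finset.range A.card)
    (numAbove A ord) (fun u hu => by simpa using numAbove_lt_card hA hu)
    (numAbove_injOn hA) (by simp)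
  simpa using hsurj (show k ∈ (Finset.range A.card : Set ℕ) by simpa using hk)

theorem lt_iff_numAbove_lt_gap {σ : β ≃ Fin n} (hσ : Extends A ord σ)
    {u z : β} (hu : u ∈ A) : σ u < σ z ↔ numAbove A ord u < gap A z σ := by
  constructor
  · intro huz
    apply Finset.card_lt_card
    rw [Finset.ssubset_iff_of_subset]
    · exact ⟨u, by simp [hu, huz], by simp [hσ u hu u hu]⟩
    · intro w hw
      rw [Finset.mem_filter] at hw ⊢
      exact ⟨hw.1, ((hσ w hw.1 u hu).1 hw.2).trans huz⟩
  · contrapose!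
    intro hzu
    apply Finset.card_le_card
    intro w hw
    rw [Finset.mem_filter] at hw ⊢
    exact ⟨hw.1, (hσ w hw.1 u hu).2 (hw.2.trans_le hzu)⟩

theorem gap_le_card (z : β) (σ : β ≃ Fin n) : gap A z σ ≤ A.card :=
  Finset.card_filter_le _ _

/-- After swapping `z ∉ A` with `u ∈ A`, the elements of `A` above `z` are those
that were above `u`, together with `u` itself if `z` was above it. -/
theorem gap_swap [DecidableEq β] {σ : β ≃ Fin n} (hσ : Extends A ord σ) {u z : β} (hu : u ∈ A) (hz : z ∉ A) :
    gap A z ((Equiv.swap z u).trans σ) =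
      numAbove A ord u + if σ z < σ u then 1 else 0 := by
  have key : ∀ v ∈ A, v ≠ u → (Equiv.swap z u) v = v := fun v hv hvu =>
    Equiv.swap_apply_of_ne_of_ne (fun h => hz (h ▸ hv)) hvu
  unfold gap numAbove
  have hirr : ¬ ord u u := by simp [hσ u hu u hu]
  split_ifs with hzu
  · rw [← Finset.card_insert_of_notMem (a := u) (by simp [hirr])]
    congr 1
    ext v
    by_cases hvu : v = u
    · subst hvu
      simp [hu, hzu]
    · simp only [Finset.mem_filter, Finset.mem_insert, hvu, false_or, Equiv.trans_apply,
        Equiv.swap_apply_left]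
      refine and_congr_right fun hv => ?_
      rw [key v hv hvu, hσ v hv u hu]
  · rw [add_zero]
    congr 1
    ext v
    by_cases hvu : v = u
    · subst hvu
      simp [hirr, not_lt.1 hzu]
    · simp only [Finset.mem_filter, Equiv.trans_apply, Equiv.swap_apply_left]
      refine and_congr_right fun hv => ?_
      rw [key v hv hvu, hσ v hv u hu]

variable [Fintype β] [DecidableEq β]

theorem card_gap_succ (hA : StrictLinearOn A ord) {z : β} (hz : z ∉ A) {k : ℕ}
    (hk : k < A.card) :
    (Finset.univ.filter (fun σ : β ≃ Fin n => Extends A ord σ ∧ gap A z σ = k + 1)).card =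
      (Finset.univ.filter (fun σ : β ≃ Fin n => Extends A ord σ ∧ gap A z σ = k)).card := by
  obtain ⟨u, hu, huk⟩ := exists_numAbove_eq hA hk
  have hinv : ∀ σ : β ≃ Fin n,
      (Equiv.swap z u).trans ((Equiv.swap z u).trans σ) = σ := by
    intro σ
    ext v
    simp
  have hadj : ∀ σ : β ≃ Fin n, Extends A ord σ → (gap A z σ = k ∨ gap A z σ = k + 1) →
      ∀ v ∈ A, v ≠ u → (σ v < σ z ↔ σ v < σ u) := by
    intro σ hσ hgap v hv hvu
    rw [lt_iff_numAbove_lt_gap hσ hv, ← hσ v hv u hu, ← numAbove_lt_iff hA hv hu]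
    have hne : numAbove A ord v ≠ numAbove A ord u :=
      fun h => hvu (numAbove_injOn hA hv hu h)
    omega
  apply Finset.card_nbij' (fun σ => (Equiv.swap z u).trans σ)
    (fun σ => (Equiv.swap z u).trans σ)
  · intro σ hσ
    simp only [Finset.coe_filter, Finset.mem_univ, true_and, Set.mem_ofPred_eq] at hσ ⊢
    refine ⟨hσ.1.swap hz (hadj σ hσ.1 (Or.inr hσ.2)), ?_⟩
    have hlt : σ u < σ z := (lt_iff_numAbove_lt_gap hσ.1 hu).2 (by omega)
    rw [gap_swap hσ.1 hu hz, if_neg hlt.asymm, huk, add_zero]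
  · intro σ hσ
    simp only [Finset.coe_filter, Finset.mem_univ, true_and, Set.mem_ofPred_eq] at hσ ⊢
    refine ⟨hσ.1.swap hz (hadj σ hσ.1 (Or.inl hσ.2)), ?_⟩
    have hle : ¬ σ u < σ z := by
      rw [lt_iff_numAbove_lt_gap hσ.1 hu]
      omega
    have hne : σ u ≠ σ z := σ.injective.ne fun h => hz (h ▸ hu)
    rw [gap_swap hσ.1 hu hz, if_pos (lt_of_le_of_ne (not_lt.1 hle) hne.symm), huk]
  · exact fun σ _ => hinv σ
  · exact fun σ _ => hinv σ

theorem card_gap_eq (hA : StrictLinearOn A ord) {z : β} (hz : z ∉ A) {k : ℕ}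
    (hk : k ≤ A.card) :
    (Finset.univ.filter (fun σ : β ≃ Fin n => Extends A ord σ ∧ gap A z σ = k)).card =
      (Finset.univ.filter (fun σ : β ≃ Fin n => Extends A ord σ ∧ gap A z σ = 0)).card := by
  induction k with
  | zero => rfl
  | succ k ih => rw [card_gap_succ hA hz hk, ih (by omega)]

theorem card_gap_lt (hA : StrictLinearOn A ord) {z : β} (hz : z ∉ A) {j : ℕ}
    (hj : j ≤ A.card + 1) :
    (Finset.univ.filter (fun σ : β ≃ Fin n => Extends A ord σ ∧ gap A z σ < j)).card =
      j * (Finset.univ.filter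
        (fun σ : β ≃ Fin n => Extends A ord σ ∧ gap A z σ = 0)).card := by
  rw [Finset.card_eq_sum_card_fiberwise (f := gap A z) (t := Finset.range j)
    (fun σ hσ => by simp at hσ ⊢; exact hσ.2)]
  rw [← Finset.card_range j, ← smul_eq_mul, ← Finset.sum_const, Finset.card_range]
  refine Finset.sum_congr rfl fun k hk => ?_
  rw [Finset.mem_range] at hk
  rw [← card_gap_eq hA hz (k := k) (by omega), Finset.filter_filter]
  congr 1
  ext σ
  simp only [Finset.mem_filter, Finset.mem_univ, true_and]
  grind

/-- An element outside `A` is above `x ∈ A` in a proportion `h / (|A| + 1)` of the extensions,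
where `h` is the rank of `x` within `A`. -/
theorem card_above_mul (hA : StrictLinearOn A ord) {x z : β} (hx : x ∈ A) (hz : z ∉ A) :
    (A.card + 1) *
        (Finset.univ.filter (fun σ : β ≃ Fin n => Extends A ord σ ∧ σ z < σ x)).card =
      (numAbove A ord x + 1) *
        (Finset.univ.filter (fun σ : β ≃ Fin n => Extends A ord σ)).card := by
  have habove : (Finset.univ.filter (fun σ : β ≃ Fin n => Extends A ord σ ∧ σ z < σ x)) =
      Finset.univ.filter
        (fun σ : β ≃ Fin n => Extends A ord σ ∧ gap A z σ < numAbove A ord x + 1) := by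
    ext σ
    simp only [Finset.mem_filter, Finset.mem_univ, true_and]
    refine and_congr_right fun hσ => ?_
    have hne : σ x ≠ σ z := σ.injective.ne fun h => hz (h ▸ hx)
    have := lt_iff_numAbove_lt_gap hσ hx (z := z)
    rw [Nat.lt_succ_iff, ← not_lt, ← this, not_lt]
    exact ⟨le_of_lt, fun h => lt_of_le_of_ne h hne.symm⟩
  have hall : (Finset.univ.filter (fun σ : β ≃ Fin n => Extends A ord σ)) =
      Finset.univ.filter
        (fun σ : β ≃ Fin n => Extends A ord σ ∧ gap A z σ < A.card + 1) := by
    ext σ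
    simp only [Finset.mem_filter, Finset.mem_univ, true_and]
    exact ⟨fun h => ⟨h, Nat.lt_succ_of_le (gap_le_card z σ)⟩, fun h => h.1⟩
  have := numAbove_lt_card hA hx
  rw [habove, hall, card_gap_lt hA hz (by omega), card_gap_lt hA hz le_rfl]
  ring

theorem exists_extends (hA : StrictLinearOn A ord) :
    ∃ σ : β ≃ Fin (Fintype.card β), Extends A ord σ := by
  let key : β → ℕ := fun b =>
    if b ∈ A then numAbove A ord b else A.card + (Fintype.equivFin β b : ℕ)
  have hkey : Function.Injective key := by
    intro u v huv
    simp only [key] at huv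
    split_ifs at huv with hu hv hv
    · exact numAbove_injOn hA hu hv huv
    · have := numAbove_lt_card hA hu
      omega
    · have := numAbove_lt_card hA hv
      omega
    · exact (Fintype.equivFin β).injective (Fin.ext (by omega))
  let _ : LinearOrder β := LinearOrder.lift' key hkey
  let e : Fin (Fintype.card β) ≃o β := Fintype.orderIsoFinOfCardEq β rfl
  refine ⟨e.symm.toEquiv, fun u hu v hv => ?_⟩
  rw [← numAbove_lt_iff hA hu hv]
  have h1 : e.symm u < e.symm v ↔ u < v := e.symm.lt_iff_lt
  have h2 : u < v ↔ key u < key v := Iff.rfl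
  simp only [key, hu, hv, if_true] at h2
  exact (h1.trans h2).symm

end UniformExtension

/-- Let `A` be a finite subset of size `a` of the ambient finite type `β` (playing the
role of `B`, with `|B| = m = Fintype.card β`), carrying a fixed strict linear order
`ord` (where `ord x z` means "`x` is ranked above `z`"), and let `x ∈ A` have rank `h`
within `A`, i.e. exactly `h` elements of `A` (including `x` itself) are weakly above
`x`. Identify a strict linear order on `β` with a ranking bijection `σ : β ≃ Fin |β|`
(a smaller rank means ranked higher), so that the orders extending the fixed order on
`A` are the bijections `σ` with `ord x z ↔ σ x < σ z` for all `x, z ∈ A`. Choosing such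
an extension uniformly at random, the expected rank of `x` within `B`, i.e. the expected
number of elements of `B` weakly above `x`, equals `h + h * (m - a) / (a + 1)`. -/
theorem uniform_extension_expected_rank
    {β : Type*} [Fintype β] [DecidableEq β]
    (A : Finset β) (x : β) (hx : x ∈ A)
    (ord : β → β → Prop) [DecidableRel ord]
    (h_irr : ∀ u ∈ A, ¬ ord u u)
    (h_trans : ∀ u ∈ A, ∀ z ∈ A, ∀ w ∈ A, ord u z → ord z w → ord u w)
    (h_tot : ∀ u ∈ A, ∀ z ∈ A, u ≠ z → ord u z ∨ ord z u)
    (h : ℕ) (hh : (A.filter (fun x' => x' = x ∨ ord x' x)).card = h) :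
    ((∑ σ ∈ Finset.univ.filter (fun σ : β ≃ Fin (Fintype.card β) =>
          ∀ u ∈ A, ∀ z ∈ A, (ord u z ↔ σ u < σ z)),
        ((Finset.univ.filter (fun z : β => z = x ∨ σ z < σ x)).card : ℚ)) /
        ((Finset.univ.filter (fun σ : β ≃ Fin (Fintype.card β) =>
          ∀ u ∈ A, ∀ z ∈ A, (ord u z ↔ σ u < σ z))).card : ℚ))
      = h + h * ((Fintype.card β : ℚ) - (A.card : ℚ)) / ((A.card : ℚ) + 1) := by
  have hA : StrictLinearOn A ord := ⟨h_irr, h_trans, h_tot⟩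
  set S := Finset.univ.filter (fun σ : β ≃ Fin (Fintype.card β) =>
    ∀ u ∈ A, ∀ z ∈ A, (ord u z ↔ σ u < σ z)) with hS
  have hSmem : ∀ σ ∈ S, Extends A ord σ := fun σ hσ => (Finset.mem_filter.1 hσ).2
  have hSpos : (S.card : ℚ) ≠ 0 := by
    obtain ⟨σ, hσ⟩ := exists_extends hA
    exact_mod_cast Finset.card_ne_zero_of_mem (a := σ) (by simpa [hS] using hσ)
  have hrank : numAbove A ord x + 1 = h := by
    rw [← hh, numAbove, ← Finset.card_insert_of_notMem (a := x) (by simp [h_irr x hx])]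
    congr 1
    ext v
    by_cases hv : v = x <;> simp [hv, hx]
  have hswap : ∑ σ ∈ S, ((Finset.univ.filter (fun z : β => z = x ∨ σ z < σ x)).card : ℚ) =
      ∑ z : β, ((S.filter (fun σ => z = x ∨ σ z < σ x)).card : ℚ) := by
    exact_mod_cast Finset.sum_card_bipartiteAbove_eq_sum_card_bipartiteBelow
      (s := S) (t := Finset.univ) (fun (σ : β ≃ Fin (Fintype.card β)) (z : β) =>
        z = x ∨ σ z < σ x)
  have hin : ∑ z ∈ A, ((S.filter (fun σ => z = x ∨ σ z < σ x)).card : ℚ) = h * S.card := by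
    have hterm : ∀ z ∈ A, ((S.filter (fun σ => z = x ∨ σ z < σ x)).card : ℚ) =
        if z = x ∨ ord z x then (S.card : ℚ) else 0 := by
      intro z hz
      have hconst : ∀ σ ∈ S, ((z = x ∨ σ z < σ x) ↔ (z = x ∨ ord z x)) := fun σ hσ => by
        rw [hSmem σ hσ z hz x hx]
      rw [Finset.filter_congr hconst, Finset.filter_const]
      split_ifs <;> simp
    rw [Finset.sum_congr rfl hterm, ← Finset.sum_filter, Finset.sum_const, hh, nsmul_eq_mul]
  have hout : ∑ z ∈ Aᶜ, ((S.filter (fun σ => z = x ∨ σ z < σ x)).card : ℚ) =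
      ((Fintype.card β : ℚ) - A.card) * (h * S.card / (A.card + 1)) := by
    have hterm : ∀ z ∈ Aᶜ, ((S.filter (fun σ => z = x ∨ σ z < σ x)).card : ℚ) =
        h * S.card / (A.card + 1) := by
      intro z hz
      rw [Finset.mem_compl] at hz
      have hne : z ≠ x := fun e => hz (e ▸ hx)
      have hcount := card_above_mul (n := Fintype.card β) hA hx hz
      rw [hrank, ← Finset.filter_filter] at hcount
      rw [eq_div_iff (by positivity)]
      simp only [hne, false_or]
      rw [mul_comm]
      exact_mod_cast hcount
    rw [Finset.sum_congr rfl hterm, Finset.sum_const, nsmul_eq_mul, Finset.card_compl,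
      Nat.cast_sub (Finset.card_le_univ A)]
  rw [hswap, ← Finset.sum_add_sum_compl A, hin, hout]
  field_simp
end
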